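/- Assume q ≠ 0. Then the K-subalgebra of A generated by {T_1, …, T_n} is contained in the K-linear span of the set ℬ_n. In particular, since each inverse T_j^{-1} = q^{-1}·(T_j + (1-q)·1) lies in this subalgebra, every finite product of integer powers of the elements T_1, …, T_n lies in the K-linear span of ℬ_n. -/

import Mathlib

/-- `uElt T i j` is the element `u_i^j`: the product `T_i T_{i-1} ⋯ T_{i-j+1}`
(interpreted as `1` when `j = 0`). -/
def uElt {A : Type*} [Monoid A] (T : ℕ → A) (i j : ℕ) : A :=
  ((List.range j).map fun t => T (i - t)).prod

/-- `betaElt T n l` is the element `β_n^l = u_1^{l_1} u_2^{l_2} ⋯ u_n^{l_n}`, where the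
tuple `(l_1, …, l_n)` is encoded as `l : Fin n → ℕ` (so `l i` is `l_{i+1}`). -/
def betaElt {A : Type*} [Monoid A] (T : ℕ → A) (n : ℕ) (l : Fin n → ℕ) : A :=
  (List.ofFn fun i : Fin n => uElt T (i.1 + 1) (l i)).prod

/-- The set `ℬ_n = {β_n^l : l ∈ ℒ_n}`, where `ℒ_n` is the set of tuples `(l_1, …, l_n)`
with `0 ≤ l_j ≤ j` for each `j`. -/
def heckeBasisSet {A : Type*} [Monoid A] (T : ℕ → A) (n : ℕ) : Set A :=
  {a : A | ∃ l : Fin n → ℕ, (∀ i : Fin n, l i ≤ i.1 + 1) ∧ a = betaElt T n l}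

theorem uElt_zero' {A : Type*} [Monoid A] (T : ℕ → A) (i : ℕ) : uElt T i 0 = 1 := by
  simp [uElt]

theorem uElt_succ' {A : Type*} [Monoid A] (T : ℕ → A) (i j : ℕ) :
    uElt T i (j + 1) = uElt T i j * T (i - j) := by
  simp [uElt, List.range_succ]

theorem betaElt_succ' {A : Type*} [Monoid A] (T : ℕ → A) (m : ℕ) (l : Fin (m + 1) → ℕ) :
    betaElt T (m + 1) l =
      betaElt T m (fun i => l i.castSucc) * uElt T (m + 1) (l (Fin.last m)) := by
  unfold betaElt
  rw [List.ofFn_succ', List.concat_eq_append, List.prod_append]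
  simp

theorem uElt_comm_low {A : Type*} [Monoid A] (n : ℕ) (T : ℕ → A)
    (hc : ∀ j k, 1 ≤ k → k + 2 ≤ j → j ≤ n → T j * T k = T k * T j)
    (m k j : ℕ) (hm : m ≤ n) (hk : 1 ≤ k) (h : k + 1 + j ≤ m) :
    uElt T m j * T k = T k * uElt T m j := by
  induction j with
  | zero => simp [uElt_zero']
  | succ j ih =>
    rw [uElt_succ', mul_assoc, hc (m - j) k hk (by omega) (by omega), ← mul_assoc,
      ih (by omega), mul_assoc]

theorem uElt_comm_high {A : Type*} [Monoid A] (n : ℕ) (T : ℕ → A)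
    (hc : ∀ j k, 1 ≤ k → k + 2 ≤ j → j ≤ n → T j * T k = T k * T j)
    (hb : ∀ j, 1 ≤ j → j + 1 ≤ n →
      T j * T (j + 1) * T j = T (j + 1) * T j * T (j + 1))
    (m k j : ℕ) (hm : m ≤ n) (hk : 1 ≤ k) (hkm : k + 1 ≤ m) (hj : j ≤ m)
    (h : m + 1 ≤ j + k) :
    uElt T m j * T (k + 1) = T k * uElt T m j := by
  induction j with
  | zero => omega
  | succ j ih =>
    by_cases h1 : m + 1 ≤ j + k
    · rw [uElt_succ', mul_assoc, ← hc (k + 1) (m - j) (by omega) (by omega) (by omega),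
        ← mul_assoc, ih (by omega) h1, mul_assoc]
    · obtain ⟨i, rfl⟩ : ∃ i, j = i + 1 := ⟨j - 1, by omega⟩
      have e1 : m - i = k + 1 := by omega
      have e2 : m - (i + 1) = k := by omega
      rw [uElt_succ', uElt_succ', e1, e2]
      have := uElt_comm_low n T hc m k i hm hk (by omega)
      calc uElt T m i * T (k + 1) * T k * T (k + 1)
          = uElt T m i * (T (k + 1) * T k * T (k + 1)) := by simp only [mul_assoc]
        _ = (uElt T m i * T k) * T (k + 1) * T k := by
            rw [← hb k hk (by omega)]; simp only [mul_assoc]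
        _ = _ := by rw [this]; simp only [mul_assoc]

theorem span_mul_uElt {K : Type*} [Field K] {A : Type*} [Ring A] [Algebra K A] (T : ℕ → A)
    (m j : ℕ) (hj : j ≤ m + 1) (x : A) (hx : x ∈ Submodule.span K (heckeBasisSet T m)) :
    x * uElt T (m + 1) j ∈ Submodule.span K (heckeBasisSet T (m + 1)) := by
  induction hx using Submodule.span_induction with
  | mem x hx =>
    obtain ⟨l, hl, rfl⟩ := hx
    refine Submodule.subset_span ⟨Fin.snoc (α := fun _ => ℕ) l j, ?_, ?_⟩
    · intro i
      refine Fin.lastCases ?_ (fun i => ?_) i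
      · simpa using hj
      · simpa using hl i
    · simp [betaElt_succ']
  | zero => simp
  | add x y _ _ hx hy => rw [add_mul]; exact add_mem hx hy
  | smul a x _ hx => rw [smul_mul_assoc]; exact Submodule.smul_mem _ _ hx

theorem span_mul_T {K : Type*} [Field K] (q : K)
    {A : Type*} [Ring A] [Algebra K A] (n : ℕ) (T : ℕ → A)
    (hc : ∀ j k, 1 ≤ k → k + 2 ≤ j → j ≤ n → T j * T k = T k * T j)
    (hb : ∀ j, 1 ≤ j → j + 1 ≤ n →
      T j * T (j + 1) * T j = T (j + 1) * T j * T (j + 1))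
    (hquad : ∀ j, 1 ≤ j → j ≤ n → T j ^ 2 = (q - 1) • T j + q • (1 : A))
    (m : ℕ) (hm : m ≤ n) (k : ℕ) (hk : 1 ≤ k) (hkm : k ≤ m) (x : A)
    (hx : x ∈ Submodule.span K (heckeBasisSet T m)) :
    x * T k ∈ Submodule.span K (heckeBasisSet T m) := by
  induction m generalizing k x with
  | zero => omega
  | succ m ih =>
    induction hx using Submodule.span_induction with
    | mem x hx =>
      obtain ⟨l, hl, rfl⟩ := hx
      rw [betaElt_succ']
      have hj := hl (Fin.last m)
      simp only [Fin.val_last] at hj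
      generalize l (Fin.last m) = j at hj
      have hB : betaElt T m (fun i => l i.castSucc) ∈ Submodule.span K (heckeBasisSet T m) :=
        Submodule.subset_span ⟨_, fun i => by simpa using hl i.castSucc, rfl⟩
      generalize betaElt T m (fun i => l i.castSucc) = b at hB
      rw [mul_assoc]
      rcases lt_trichotomy (k + j) (m + 1) with h | h | h
      · rw [uElt_comm_low n T hc (m + 1) k j hm hk (by omega), ← mul_assoc]
        exact span_mul_uElt T m j hj _ (ih (by omega) k hk (by omega) b hB)
      · have e : k = m + 1 - j := by omega
        rw [e, ← uElt_succ']
        exact span_mul_uElt T m (j + 1) (by omega) _ hB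
      · by_cases h2 : k + j = m + 2
        · obtain ⟨i, rfl⟩ : ∃ i, j = i + 1 := ⟨j - 1, by omega⟩
          have e : m + 1 - i = k := by omega
          have h3 : uElt T (m + 1) (i + 1) * T k =
              (q - 1) • uElt T (m + 1) (i + 1) + q • uElt T (m + 1) i := by
            rw [uElt_succ', e, mul_assoc, ← pow_two, hquad k hk (by omega)]
            simp [mul_add]
          rw [h3, mul_add, mul_smul_comm, mul_smul_comm]
          exact add_mem (Submodule.smul_mem _ _ (span_mul_uElt T m _ hj _ hB))
            (Submodule.smul_mem _ _ (span_mul_uElt T m _ (by omega) _ hB))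
        · obtain ⟨i, rfl⟩ : ∃ i, k = i + 1 := ⟨k - 1, by omega⟩
          rw [uElt_comm_high n T hc hb (m + 1) i j hm (by omega) (by omega) hj (by omega),
            ← mul_assoc]
          exact span_mul_uElt T m j hj _ (ih (by omega) i (by omega) (by omega) b hB)
    | zero => simp
    | add x y _ _ hx hy => rw [add_mul]; exact add_mem hx hy
    | smul a x _ hx => rw [smul_mul_assoc]; exact Submodule.smul_mem _ _ hx

theorem adjoin_subset_span_basis {K : Type*} [Field K] (q : K) (hq : q ≠ 0)
    {A : Type*} [Ring A] [Algebra K A] (n : ℕ) (T : ℕ → A)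
    (hcomm : ∀ j k, 1 ≤ j → j ≤ n → 1 ≤ k → k ≤ n → 2 ≤ |(j : ℤ) - (k : ℤ)| →
      T j * T k = T k * T j)
    (hbraid : ∀ j, 1 ≤ j → j + 1 ≤ n →
      T j * T (j + 1) * T j = T (j + 1) * T j * T (j + 1))
    (hquad : ∀ j, 1 ≤ j → j ≤ n → T j ^ 2 = (q - 1) • T j + q • (1 : A)) :
    ((Algebra.adjoin K {a : A | ∃ j, 1 ≤ j ∧ j ≤ n ∧ a = T j} : Subalgebra K A) : Set A) ⊆
        (Submodule.span K (heckeBasisSet T n) : Submodule K A) ∧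
      ∀ (L : ℕ) (is : Fin L → ℕ) (ks : Fin L → ℤ) (u : Fin L → Aˣ),
        (∀ t, 1 ≤ is t ∧ is t ≤ n) → (∀ t, (u t : A) = T (is t)) →
        (List.ofFn fun t => ((u t ^ ks t : Aˣ) : A)).prod ∈
          Submodule.span K (heckeBasisSet T n) := by
  have hc : ∀ j k, 1 ≤ k → k + 2 ≤ j → j ≤ n → T j * T k = T k * T j := by
    intro j k h1 h2 h3
    refine hcomm j k (by omega) h3 h1 (by omega) ?_
    rw [abs_of_nonneg (by omega)]
    omega
  have h1 : (1 : A) ∈ Submodule.span K (heckeBasisSet T n) :=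
    Submodule.subset_span ⟨fun _ => 0, fun _ => by simp, by simp [betaElt, uElt_zero']⟩
  have key : ∀ a ∈ Algebra.adjoin K {a : A | ∃ j, 1 ≤ j ∧ j ≤ n ∧ a = T j},
      ∀ x ∈ Submodule.span K (heckeBasisSet T n),
        x * a ∈ Submodule.span K (heckeBasisSet T n) := by
    intro a ha
    induction ha using Algebra.adjoin_induction with
    | mem a ha =>
      obtain ⟨j, hj1, hj2, rfl⟩ := ha
      exact fun x hx => span_mul_T q n T hc hbraid hquad n le_rfl j hj1 hj2 x hx
    | algebraMap r =>
      intro x hx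
      rw [← Algebra.commutes, ← Algebra.smul_def]
      exact Submodule.smul_mem _ _ hx
    | add a b _ _ ha hb =>
      intro x hx
      rw [mul_add]
      exact add_mem (ha x hx) (hb x hx)
    | mul a b _ _ ha hb =>
      intro x hx
      rw [← mul_assoc]
      exact hb _ (ha x hx)
  have main : ∀ a ∈ Algebra.adjoin K {a : A | ∃ j, 1 ≤ j ∧ j ≤ n ∧ a = T j},
      a ∈ Submodule.span K (heckeBasisSet T n) := by
    intro a ha
    simpa using key a ha 1 h1
  refine ⟨fun a ha => main a ha, ?_⟩
  intro L is ks u his hu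
  apply main
  apply Subalgebra.list_prod_mem
  intro y hy
  obtain ⟨t, rfl⟩ := (List.mem_ofFn' _ _).1 hy
  have hT : (u t : A) ∈ Algebra.adjoin K {a : A | ∃ j, 1 ≤ j ∧ j ≤ n ∧ a = T j} :=
    Algebra.subset_adjoin ⟨is t, (his t).1, (his t).2, hu t⟩
  have hinv : ((u t)⁻¹ : Aˣ).val = q⁻¹ • ((u t : A) + (1 - q) • (1 : A)) := by
    refine Units.inv_eq_of_mul_eq_one_right ?_
    have h := hquad (is t) (his t).1 (his t).2
    rw [← hu t, pow_two] at h
    rw [mul_smul_comm, mul_add, h, mul_smul_comm, mul_one]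
    have e : (q - 1) • (u t : A) + q • (1 : A) + (1 - q) • (u t : A) = q • (1 : A) := by
      module
    rw [e, smul_smul, inv_mul_cancel₀ hq, one_smul]
  have hI : ((u t)⁻¹ : Aˣ).val ∈
      Algebra.adjoin K {a : A | ∃ j, 1 ≤ j ∧ j ≤ n ∧ a = T j} := by
    rw [hinv]
    exact Subalgebra.smul_mem _ (add_mem hT (Subalgebra.smul_mem _ (one_mem _) _)) _
  show ((u t ^ ks t : Aˣ) : A) ∈ _
  obtain ⟨p, hp | hp⟩ := Int.eq_nat_or_neg (ks t)
  · rw [hp, zpow_natCast, Units.val_pow_eq_pow_val]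
    exact pow_mem hT p
  · rw [hp, zpow_neg, zpow_natCast, ← inv_pow, Units.val_pow_eq_pow_val]
    exact pow_mem hI p
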